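/- Let n ≥ 2 be an integer and ξ a real number with ŵ_n(ξ) > 2n−2 (such ξ is necessarily not algebraic of degree at most n, so the best approximation sequence is defined). Then there exists a constant C > 0 such that for all sufficiently large k, L_{2n−1}(q_k) ≥ −(2n−2)·L_{P_{k−1}}(q_k) + ((2n²−5n+2)/(2n−2))·(q_k − s_k) − C. -/

import Mathlib

open Polynomial Filter

noncomputable section

/-- Height of an integer polynomial: maximum absolute value of its coefficients. -/
def polyHeight (P : Polynomial ℤ) : ℕ :=
  P.support.sup fun i => (P.coeff i).natAbs

/-- The set of exponents `w` admissible for the uniform exponent `ŵ_n(ξ)`. -/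
def uniformExpSet (n : ℕ) (ξ : ℝ) : Set ℝ :=
  {w | ∀ᶠ X : ℝ in atTop, ∃ P : Polynomial ℤ, P.natDegree ≤ n ∧
    (polyHeight P : ℝ) ≤ X ∧ 0 < |Polynomial.aeval ξ P| ∧
    |Polynomial.aeval ξ P| < X ^ (-w)}

/-- The uniform exponent `ŵ_n(ξ)`, as an extended real. -/
def wHat (n : ℕ) (ξ : ℝ) : EReal :=
  sSup ((fun w : ℝ => (w : EReal)) '' uniformExpSet n ξ)

/-- The set of exponents `w` admissible for the ordinary exponent `w_n(ξ)`. -/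
def ordExpSet (n : ℕ) (ξ : ℝ) : Set ℝ :=
  {w | {P : Polynomial ℤ | P.natDegree ≤ n ∧ 0 < |Polynomial.aeval ξ P| ∧
      |Polynomial.aeval ξ P| < (polyHeight P : ℝ) ^ (-w)}.Infinite}

/-- The ordinary exponent `w_n(ξ)`, as an extended real. -/
def wOrd (n : ℕ) (ξ : ℝ) : EReal :=
  sSup ((fun w : ℝ => (w : EReal)) '' ordExpSet n ξ)

/-- `P` (1-indexed: the relevant values are `P 1, P 2, …`) is the sequence of best
approximation polynomials associated to `(n, ξ)`. -/
structure IsBestApproxSeq (n : ℕ) (ξ : ℝ) (P : ℕ → Polynomial ℤ) : Prop where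
  ne_zero : ∀ k, 1 ≤ k → P k ≠ 0
  deg_le : ∀ k, 1 ≤ k → (P k).natDegree ≤ n
  height_lt : ∀ k, 1 ≤ k → polyHeight (P k) < polyHeight (P (k+1))
  eval_lt : ∀ k, 1 ≤ k → |Polynomial.aeval ξ (P (k+1))| < |Polynomial.aeval ξ (P k)|
  isMin : ∀ k, 1 ≤ k → ∀ Q : Polynomial ℤ, Q ≠ 0 → Q.natDegree ≤ n →
    polyHeight Q ≤ polyHeight (P k) →
    |Polynomial.aeval ξ (P k)| ≤ |Polynomial.aeval ξ Q|
  complete : ∀ Q : Polynomial ℤ, Q ≠ 0 → Q.natDegree ≤ n →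
    (∀ R : Polynomial ℤ, R ≠ 0 → R.natDegree ≤ n → polyHeight R ≤ polyHeight Q →
      |Polynomial.aeval ξ Q| ≤ |Polynomial.aeval ξ R|) →
    ∃ k, 1 ≤ k ∧ (Q = P k ∨ Q = -P k)

/-- The image of an integer polynomial in `ℚ[X]`. -/
def ratPoly (P : Polynomial ℤ) : Polynomial ℚ := P.map (Int.castRingHom ℚ)

/-- `k` is good for the sequence `P`: `P_{k-1}, P_k, P_{k+1}` are `ℚ`-linearly independent. -/
def Good (P : ℕ → Polynomial ℤ) (k : ℕ) : Prop :=
  LinearIndependent ℚ ![ratPoly (P (k-1)), ratPoly (P k), ratPoly (P (k+1))]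

/-- `τ_k = log H_k / log H_{k-1}`. -/
def tauk (P : ℕ → Polynomial ℤ) (k : ℕ) : ℝ :=
  Real.log (polyHeight (P k)) / Real.log (polyHeight (P (k-1)))

/-- `μ_k = -log |P_{k-1}(ξ)| / log H_k`. -/
def muk (ξ : ℝ) (P : ℕ → Polynomial ℤ) (k : ℕ) : ℝ :=
  - Real.log |Polynomial.aeval ξ (P (k-1))| / Real.log (polyHeight (P k))

/-- `v_k = -log |P_k(ξ)| / log H_k`. -/
def vk (ξ : ℝ) (P : ℕ → Polynomial ℤ) (k : ℕ) : ℝ :=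
  - Real.log |Polynomial.aeval ξ (P k)| / Real.log (polyHeight (P k))

/-- The set of integers `m ≥ k+1` such that `P_{k-1}, …, P_{m-1}` all lie in the
two-dimensional space spanned by `P_{k-1}` and `P_k`; its greatest element is `ℓ(k)`. -/
def ellSet (P : ℕ → Polynomial ℤ) (k : ℕ) : Set ℕ :=
  {m | k + 1 ≤ m ∧ ∀ j, k - 1 ≤ j → j ≤ m - 1 →
    ratPoly (P j) ∈ Submodule.span ℚ {ratPoly (P (k-1)), ratPoly (P k)}}

/-- The set `V_k = {P, T·P, …, T^{n-2}·P}` (as rational polynomials). -/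
def Vset (n : ℕ) (A : Polynomial ℤ) : Set (Polynomial ℚ) :=
  {q | ∃ i ≤ n - 2, q = Polynomial.X ^ i * ratPoly A}

/-- The trajectory `L_P(q) = max(log H(P) - q/(2n-2), log |P(ξ)| + q)`. -/
def LPtraj (n : ℕ) (ξ : ℝ) (Q : Polynomial ℤ) (q : ℝ) : ℝ :=
  max (Real.log (polyHeight Q) - q / (2*(n:ℝ)-2)) (Real.log |Polynomial.aeval ξ Q| + q)

/-- The `j`-th successive minimum function `L_j(q)`: the infimum over sets of `j`
linearly independent integer polynomials of degree at most `2n-2` of the maximum of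
`L_P(q)` over the set. -/
def Lj (n : ℕ) (ξ : ℝ) (j : ℕ) (q : ℝ) : ℝ :=
  sInf {y : ℝ | ∃ S : Finset (Polynomial ℤ), S.card = j ∧
    (∀ Q ∈ S, Q.natDegree ≤ 2*n-2) ∧
    LinearIndependent ℚ (fun Q : {x // x ∈ S} => ratPoly (Q : Polynomial ℤ)) ∧
    y = sSup ((fun Q => LPtraj n ξ Q q) '' (S : Set (Polynomial ℤ)))}

theorem abs_coeff_le_polyHeight (Q : ℤ[X]) (j : ℕ) : |(Q.coeff j : ℝ)| ≤ polyHeight Q := by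
  by_cases hj : j ∈ Q.support
  · have h : (Q.coeff j).natAbs ≤ polyHeight Q :=
      Finset.le_sup (f := fun i => (Q.coeff i).natAbs) hj
    rw [← Int.cast_abs, Int.abs_eq_natAbs]
    exact_mod_cast h
  · simp [notMem_support_iff.mp hj]

theorem one_le_polyHeight {Q : ℤ[X]} (hQ : Q ≠ 0) : 1 ≤ polyHeight Q := by
  have h : (Q.coeff Q.natDegree).natAbs ≤ polyHeight Q :=
    Finset.le_sup (f := fun i => (Q.coeff i).natAbs) (natDegree_mem_support_of_nonzero hQ)
  have : Q.coeff Q.natDegree ≠ 0 := leadingCoeff_ne_zero.mpr hQ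
  omega

theorem polyHeight_le {Q : ℤ[X]} {B : ℕ} (h : ∀ j, (Q.coeff j).natAbs ≤ B) : polyHeight Q ≤ B :=
  Finset.sup_le fun j _ => h j

theorem polyHeight_neg (Q : ℤ[X]) : polyHeight (-Q) = polyHeight Q := by
  simp [polyHeight]

theorem abs_coeff_X_pow_mul_le (Q : ℤ[X]) (i j : ℕ) :
    |((X ^ i * Q).coeff j : ℝ)| ≤ polyHeight Q := by
  rw [coeff_X_pow_mul']
  split_ifs
  · exact abs_coeff_le_polyHeight Q _
  · simp

theorem ratPoly_X_pow_mul (i : ℕ) (A : ℤ[X]) : ratPoly (X ^ i * A) = X ^ i * ratPoly A := by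
  simp [ratPoly]

theorem natDegree_ratPoly (A : ℤ[X]) : (ratPoly A).natDegree = A.natDegree :=
  natDegree_map_eq_of_injective (RingHom.injective_int _) A

/-- The coefficient determinant of a full linearly independent family of integer polynomials is a
nonzero integer; replacing its constant column by the values at `ξ` bounds it from above. -/
theorem one_le_of_linearIndependent_ratPoly {ι : Type*} [Fintype ι] [DecidableEq ι] [Nonempty ι]
    (ξ : ℝ) (Q : ι → ℤ[X]) (hdeg : ∀ i, (Q i).natDegree < Fintype.card ι)
    (hli : LinearIndependent ℚ fun i => ratPoly (Q i)) (h e : ι → ℝ) (B : ℝ)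
    (hh : ∀ i j, |((Q i).coeff j : ℝ)| ≤ h i) (he : ∀ i, |aeval ξ (Q i)| ≤ e i)
    (hpos : ∀ i, 0 < h i) (hB : ∀ i, e i * ∏ j, h j ≤ B * h i) :
    1 ≤ (Fintype.card ι).factorial * B := by
  set f := Fintype.equivFin ι
  let A : Matrix ι ι ℤ := Matrix.of fun i j => (Q i).coeff (f j)
  have hdetQ : (A.map (Int.castRingHom ℚ)).det ≠ 0 := by
    rw [← isUnit_iff_ne_zero, ← Matrix.isUnit_iff_isUnit_det,
      ← Matrix.linearIndependent_rows_iff_isUnit, Fintype.linearIndependent_iff]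
    rw [Fintype.linearIndependent_iff] at hli
    intro g hg
    apply hli
    ext j
    simp only [finsetSum_coeff, coeff_smul, coeff_zero, ratPoly, coeff_map]
    by_cases hj : j < Fintype.card ι
    · have := congrFun hg (f.symm ⟨j, hj⟩)
      simpa [A, Matrix.row] using this
    · refine Finset.sum_eq_zero fun i _ => ?_
      rw [coeff_eq_zero_of_natDegree_lt ((hdeg i).trans_le (not_lt.mp hj))]
      simp
  have hdet : A.det ≠ 0 := by
    intro h0
    apply hdetQ
    rw [← RingHom.mapMatrix_apply, ← RingHom.map_det, h0, map_zero]
  have hcard : 0 < Fintype.card ι := Fintype.card_pos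
  let j₀ : ι := f.symm ⟨0, hcard⟩
  let M : Matrix ι ι ℝ := A.map (Int.castRingHom ℝ)
  have hM : M.det = (A.det : ℝ) := by
    simp only [M]
    rw [← RingHom.mapMatrix_apply, ← RingHom.map_det]; rfl
  have hupd : (M.updateCol j₀ fun i => aeval ξ (Q i)).det = M.det := by
    have h1 := Matrix.det_updateCol_sum M j₀ fun j => ξ ^ (f j : ℕ)
    have h2 : (fun k ↦ ∑ i, (ξ ^ (f i : ℕ)) • M k i) = fun i => aeval ξ (Q i) := by
      funext i
      rw [aeval_eq_sum_range' (hdeg i), ← Fin.sum_univ_eq_sum_range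
        (fun j => (Q i).coeff j • ξ ^ j), ← f.sum_comp]
      refine Finset.sum_congr rfl fun j _ => ?_
      simp [M, A, mul_comm]
    rw [h2] at h1
    simpa [j₀] using h1
  have hprod : ∀ σ : Equiv.Perm ι,
      |∏ i, (M.updateCol j₀ fun i => aeval ξ (Q i)) (σ i) i| ≤ B := by
    intro σ
    rw [Finset.abs_prod, ← Finset.mul_prod_erase _ _ (Finset.mem_univ j₀)]
    have h1 : ∏ i ∈ Finset.univ.erase j₀,
        |(M.updateCol j₀ fun i => aeval ξ (Q i)) (σ i) i| ≤
        ∏ i ∈ Finset.univ.erase j₀, h (σ i) := by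
      refine Finset.prod_le_prod (fun _ _ => abs_nonneg _) fun i hi => ?_
      rw [Matrix.updateCol_ne (Finset.ne_of_mem_erase hi)]
      exact hh _ _
    have h2 : h (σ j₀) * ∏ i ∈ Finset.univ.erase j₀, h (σ i) = ∏ i, h i := by
      rw [Finset.mul_prod_erase _ (fun i => h (σ i)) (Finset.mem_univ j₀), Equiv.prod_comp σ h]
    have h3 := hB (σ j₀)
    rw [← h2] at h3
    have h4 : e (σ j₀) * ∏ i ∈ Finset.univ.erase j₀, h (σ i) ≤ B := by
      refine le_of_mul_le_mul_right ?_ (hpos (σ j₀))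
      linarith
    refine le_trans ?_ h4
    rw [Matrix.updateCol_self]
    exact mul_le_mul (he _) h1 (Finset.prod_nonneg fun _ _ => abs_nonneg _)
      ((abs_nonneg _).trans (he _))
  have h1 : (1 : ℝ) ≤ |M.det| := by
    rw [hM, ← Int.cast_abs]
    exact_mod_cast Int.one_le_abs hdet
  refine h1.trans ?_
  rw [← hupd, Matrix.det_apply']
  refine (Finset.abs_sum_le_sum_abs _ _).trans ?_
  refine (Finset.sum_le_card_nsmul _ _ B fun σ _ => ?_).trans ?_
  · rw [abs_mul]
    have : |((Equiv.Perm.sign σ : ℤ) : ℝ)| = 1 := by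
      rw [← Int.cast_abs, Int.abs_eq_natAbs, Int.units_natAbs]; simp
    rw [this, one_mul]
    exact hprod σ
  · rw [Finset.card_univ, Fintype.card_perm, nsmul_eq_mul]

/-- Shifts of two coprime polynomials are linearly independent as long as the number of shifts of
each does not exceed the degree of the other. -/
theorem linearIndependent_shifts {F G : ℚ[X]} (hF : F ≠ 0) (hG : G ≠ 0) (hFG : IsCoprime F G)
    {r s : ℕ} (hr : r ≤ G.natDegree) (hs : s ≤ F.natDegree) :
    LinearIndependent ℚ (Sum.elim (fun i : Fin r => X ^ (i : ℕ) * F)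
      (fun j : Fin s => X ^ (j : ℕ) * G)) := by
  rw [Fintype.linearIndependent_iff]
  intro g hg
  have key : ∀ {t : ℕ} (c : Fin t → ℚ), (∑ i, c i • (X : ℚ[X]) ^ (i : ℕ)).degree < t := by
    intro t c
    rw [← mem_degreeLT]
    refine Submodule.sum_mem _ fun i _ => Submodule.smul_mem _ _ ?_
    rw [mem_degreeLT, degree_X_pow]
    exact_mod_cast i.2
  have coeff_zero_of : ∀ {t : ℕ} (c : Fin t → ℚ), ∑ i, c i • (X : ℚ[X]) ^ (i : ℕ) = 0 →
      ∀ i, c i = 0 := by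
    intro t c h i
    have := congrArg (fun p => p.coeff (i : ℕ)) h
    simpa [finsetSum_coeff, coeff_X_pow, Fin.val_inj] using this
  set A : ℚ[X] := ∑ i, g (Sum.inl i) • X ^ (i : ℕ) with hA
  set B : ℚ[X] := ∑ j, g (Sum.inr j) • X ^ (j : ℕ) with hB
  have hAB : A * F + B * G = 0 := by
    rw [← hg, Fintype.sum_sum_type, hA, hB, Finset.sum_mul, Finset.sum_mul]
    simp
  have hA0 : A = 0 := by
    have hd : G ∣ A * F := ⟨-B, by linear_combination hAB⟩
    refine eq_zero_of_dvd_of_degree_lt (hFG.symm.dvd_of_dvd_mul_right hd) ((key _).trans_le ?_)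
    rw [degree_eq_natDegree hG]
    exact_mod_cast hr
  have hB0 : B = 0 := by
    have hd : F ∣ B * G := ⟨-A, by linear_combination hAB⟩
    refine eq_zero_of_dvd_of_degree_lt (hFG.dvd_of_dvd_mul_right hd) ((key _).trans_le ?_)
    rw [degree_eq_natDegree hF]
    exact_mod_cast hs
  rintro (i | j)
  · exact coeff_zero_of _ hA0 i
  · exact coeff_zero_of _ hB0 j

/-- The Mahler measure of an integer polynomial. -/
def intMahler (Q : ℤ[X]) : ℝ := (Q.map (Int.castRingHom ℂ)).mahlerMeasure

theorem intMahler_mul (A B : ℤ[X]) : intMahler (A * B) = intMahler A * intMahler B := by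
  simp [intMahler, mahlerMeasure_mul]

theorem one_le_intMahler {Q : ℤ[X]} (hQ : Q ≠ 0) : 1 ≤ intMahler Q :=
  one_le_mahlerMeasure_of_ne_zero hQ

theorem polyHeight_le_intMahler {n : ℕ} {Q : ℤ[X]} (hQ : Q.natDegree ≤ n) :
    (polyHeight Q : ℝ) ≤ 2 ^ n * intMahler Q := by
  by_cases h0 : Q = 0
  · simp [h0, polyHeight, intMahler]
  obtain ⟨i, -, hi⟩ := Finset.exists_mem_eq_sup Q.support (support_nonempty.mpr h0)
    (fun i => (Q.coeff i).natAbs)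
  have h1 := norm_coeff_le_choose_mul_mahlerMeasure i (Q.map (Int.castRingHom ℂ))
  rw [natDegree_map_eq_of_injective (RingHom.injective_int _) Q, coeff_map] at h1
  have h2 : (polyHeight Q : ℝ) = ‖(Int.castRingHom ℂ) (Q.coeff i)‖ := by
    simp only [polyHeight, hi, eq_intCast, Complex.norm_intCast]
    rw [← Int.cast_abs, Int.abs_eq_natAbs]; simp
  rw [h2]
  refine h1.trans ?_
  have h3 : (Q.natDegree.choose i : ℝ) ≤ 2 ^ n := by
    exact_mod_cast (Nat.choose_le_two_pow _ _).trans (Nat.pow_le_pow_right (by norm_num) hQ)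
  exact mul_le_mul_of_nonneg_right h3 (mahlerMeasure_nonneg _)

theorem intMahler_le_polyHeight {n : ℕ} {Q : ℤ[X]} (hQ : Q.natDegree ≤ n) :
    intMahler Q ≤ (n + 1) * polyHeight Q := by
  refine (mahlerMeasure_le_sum_norm_coeff _).trans ?_
  rw [sum_over_range' _ (by simp) (n + 1)
    (by rw [natDegree_map_eq_of_injective (RingHom.injective_int _) Q]; omega)]
  refine (Finset.sum_le_card_nsmul _ _ (polyHeight Q : ℝ) fun j _ => ?_).trans ?_
  · simpa using abs_coeff_le_polyHeight Q j
  · simp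

theorem abs_aeval_X_pow_mul_le (ξ : ℝ) (Q : ℤ[X]) {i m : ℕ} (hi : i ≤ m) :
    |aeval ξ (X ^ i * Q)| ≤ max 1 |ξ| ^ m * |aeval ξ Q| := by
  rw [map_mul, map_pow, aeval_X, abs_mul, abs_pow]
  refine mul_le_mul_of_nonneg_right ?_ (abs_nonneg _)
  exact (pow_le_pow_left₀ (abs_nonneg _) (le_max_right _ _) i).trans
    (pow_le_pow_right₀ (le_max_left _ _) hi)

theorem eventually_pow_mul_rpow_neg_lt {N : ℕ} {w : ℝ} (hw : (N : ℝ) < w) {g ε : ℝ} (hg : 0 < g)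
    (hε : 0 < ε) : ∀ᶠ H : ℝ in atTop, H ^ N * (H / g) ^ (-w) < ε := by
  have h1 : Tendsto (fun H : ℝ => g ^ w * H ^ (-(w - N))) atTop (nhds 0) := by
    simpa using (tendsto_rpow_neg_atTop (sub_pos.mpr hw)).const_mul (g ^ w)
  filter_upwards [h1.eventually (gt_mem_nhds hε), eventually_gt_atTop 0] with H hH hpos
  refine lt_of_eq_of_lt ?_ hH
  rw [Real.div_rpow hpos.le hg.le, Real.rpow_neg hg.le, ← Real.rpow_natCast, div_inv_eq_mul,
    ← mul_assoc, ← Real.rpow_add hpos, mul_comm]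
  congr 2
  ring

namespace IsBestApproxSeq

variable {n : ℕ} {ξ : ℝ} {P : ℕ → ℤ[X]}

theorem abs_aeval_pos (hP : IsBestApproxSeq n ξ P) {k : ℕ} (hk : 1 ≤ k) :
    0 < |aeval ξ (P k)| :=
  (abs_nonneg _).trans_lt (hP.eval_lt k hk)

theorem le_polyHeight (hP : IsBestApproxSeq n ξ P) {k : ℕ} (hk : 1 ≤ k) :
    k ≤ polyHeight (P k) := by
  induction k, hk using Nat.le_induction with
  | base => exact one_le_polyHeight (hP.ne_zero 1 le_rfl)
  | succ k hk ih => exact ih.trans_lt (hP.height_lt k hk)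

theorem tendsto_polyHeight (hP : IsBestApproxSeq n ξ P) :
    Tendsto (fun k => (polyHeight (P k) : ℝ)) atTop atTop := by
  refine tendsto_atTop_mono' _ ?_ tendsto_natCast_atTop_atTop
  filter_upwards [eventually_ge_atTop 1] with k hk
  exact_mod_cast hP.le_polyHeight hk

/-- Liouville-type lower bound for irreducible polynomials of degree less than `n`. -/
theorem exists_lower_bound_irreducible (hn : 2 ≤ n) (hP : IsBestApproxSeq n ξ P) {w : ℝ}
    (hw : ((2 * n - 2 : ℕ) : ℝ) < w) (hmem : w ∈ uniformExpSet n ξ) :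
    ∃ c : ℝ, 0 < c ∧ ∀ D : ℤ[X], Irreducible D → 1 ≤ D.natDegree → D.natDegree ≤ n - 1 →
      c ≤ |aeval ξ D| * (polyHeight D : ℝ) ^ (2 * n - 2) := by
  set N := 2 * n - 2 with hN
  set K : ℝ := max 1 |ξ| ^ n with hK
  have hK1 : 1 ≤ K := one_le_pow₀ (le_max_left _ _)
  set F : ℝ := ((2 * n - 1).factorial : ℝ) with hF
  have hF1 : 1 ≤ F := by
    rw [hF]
    exact_mod_cast Nat.factorial_pos _
  have hFK : 0 < F * K := by positivity
  set g : ℝ := 2 * (2 ^ n * (n + 1)) with hg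
  have hgpos : 0 < g := by positivity
  have hev1 : ∀ᶠ H : ℝ in atTop, ∃ Q : ℤ[X], Q.natDegree ≤ n ∧ (polyHeight Q : ℝ) ≤ H / g ∧
      0 < |aeval ξ Q| ∧ |aeval ξ Q| < (H / g) ^ (-w) :=
    (tendsto_id.atTop_div_const hgpos).eventually hmem
  obtain ⟨H₀, hH₀⟩ := ((hev1.and (eventually_pow_mul_rpow_neg_lt hw hgpos
    (inv_pos.mpr hFK)))).exists_forall_of_atTop
  obtain ⟨k, hkH, hk⟩ := ((hP.tendsto_polyHeight.eventually_ge_atTop H₀).and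
    (eventually_ge_atTop 1)).exists
  refine ⟨min |aeval ξ (P k)| (F * K)⁻¹, lt_min (hP.abs_aeval_pos hk) (inv_pos.mpr hFK), ?_⟩
  intro D hD hD1 hDn
  have hD0 : D ≠ 0 := hD.ne_zero
  have hH1 : (1 : ℝ) ≤ polyHeight D := by exact_mod_cast one_le_polyHeight hD0
  set H : ℝ := (polyHeight D : ℝ) with hHdef
  by_cases hsmall : H ≤ polyHeight (P k)
  · have h1 := hP.isMin k hk D hD0 (by omega) (Nat.cast_le.mp hsmall)
    refine (min_le_left _ _).trans (h1.trans ?_)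
    exact le_mul_of_one_le_right (abs_nonneg _) (one_le_pow₀ hH1)
  obtain ⟨⟨Q, hQn, hQH, hQpos, hQw⟩, hlt⟩ := hH₀ H (hkH.trans (not_le.mp hsmall).le)
  have hQ0 : Q ≠ 0 := by rintro rfl; simp at hQpos
  have hprim : D.IsPrimitive := hD.isPrimitive (by omega)
  have hndvd : ¬ D ∣ Q := by
    rintro ⟨R, hR⟩
    have hR0 : R ≠ 0 := by rintro rfl; simp [hQ0] at hR
    have h1 : H ≤ 2 ^ n * intMahler D := polyHeight_le_intMahler (by omega)
    have h2 : intMahler D ≤ intMahler Q := by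
      rw [hR, intMahler_mul]
      exact le_mul_of_one_le_right (zero_le_one.trans (one_le_intMahler hD0))
        (one_le_intMahler hR0)
    have h3 : intMahler Q ≤ (n + 1) * (H / g) :=
      (intMahler_le_polyHeight hQn).trans (by gcongr)
    have h4 : H ≤ 2 ^ n * ((n + 1) * (H / g)) := h1.trans (by gcongr; exact h2.trans h3)
    have h5 : 2 ^ n * ((n + 1) * (H / g)) = H / 2 := by rw [hg]; field_simp
    linarith
  have hcop : IsCoprime (ratPoly D) (ratPoly Q) := by
    have hirr : Irreducible (ratPoly D) :=
      (IsPrimitive.Int.irreducible_iff_irreducible_map_cast hprim).mp hD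
    refine (hirr.coprime_iff_not_dvd).mpr fun h => hndvd ?_
    exact (IsPrimitive.Int.dvd_iff_map_cast_dvd_map_cast D Q hprim).mpr h
  have hinj : ∀ {A : ℤ[X]}, A ≠ 0 → ratPoly A ≠ 0 := fun {A} hA =>
    (Polynomial.map_ne_zero_iff (RingHom.injective_int (Int.castRingHom ℚ))).mpr hA
  have hli := linearIndependent_shifts (hinj hD0) (hinj hQ0) hcop
    (natDegree_ratPoly Q).ge (natDegree_ratPoly D).ge
  set a := D.natDegree with ha
  set b := Q.natDegree with hb
  have : Nonempty (Fin b ⊕ Fin a) := ⟨Sum.inr ⟨0, hD1⟩⟩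
  set V : ℝ := max |aeval ξ D| |aeval ξ Q| with hV
  have hHpow : H ^ b * H ^ a ≤ H ^ N * H := by
    rw [← pow_add, ← pow_succ]
    exact pow_le_pow_right₀ hH1 (by omega)
  have hQH' : (polyHeight Q : ℝ) ≤ H := hQH.trans (div_le_self (by linarith) (by
    have : (1 : ℝ) ≤ 2 ^ n := one_le_pow₀ (by norm_num)
    rw [hg]; nlinarith [(Nat.cast_nonneg n : (0 : ℝ) ≤ n)]))
  have key := one_le_of_linearIndependent_ratPoly ξ
    (Sum.elim (fun i : Fin b => X ^ (i : ℕ) * D) (fun j : Fin a => X ^ (j : ℕ) * Q))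
    (by
      rintro (i | j)
      · have h := natDegree_mul_le (p := (X : ℤ[X]) ^ (i : ℕ)) (q := D)
        rw [natDegree_X_pow] at h
        simp only [Sum.elim_inl, Fintype.card_sum, Fintype.card_fin]
        have := i.2
        omega
      · have h := natDegree_mul_le (p := (X : ℤ[X]) ^ (j : ℕ)) (q := Q)
        rw [natDegree_X_pow] at h
        simp only [Sum.elim_inr, Fintype.card_sum, Fintype.card_fin]
        have := j.2
        omega)
    (by
      convert hli using 1
      funext i
      rcases i with i | j <;> simp [ratPoly_X_pow_mul])
    (fun _ => H) (fun _ => K * V) (K * V * H ^ N)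
    (by
      rintro (i | j) m
      · exact abs_coeff_X_pow_mul_le D i m
      · exact (abs_coeff_X_pow_mul_le Q j m).trans hQH')
    (by
      rintro (i | j)
      · refine (abs_aeval_X_pow_mul_le ξ D (i.2.le.trans hQn)).trans ?_
        exact mul_le_mul_of_nonneg_left (le_max_left _ _) (by positivity)
      · refine (abs_aeval_X_pow_mul_le (m := n) ξ Q (j.2.le.trans (by omega))).trans ?_
        exact mul_le_mul_of_nonneg_left (le_max_right _ _) (by positivity))
    (fun _ => by linarith)
    (by
      intro _
      rw [Fintype.prod_sum_type]
      simp only [Finset.prod_const, Finset.card_univ, Fintype.card_fin]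
      rw [mul_assoc (K * V)]
      gcongr)
  have hfac : ((Fintype.card (Fin b ⊕ Fin a)).factorial : ℝ) ≤ F := by
    rw [hF, Fintype.card_sum, Fintype.card_fin, Fintype.card_fin]
    exact_mod_cast Nat.factorial_le (by omega)
  have hkey : 1 ≤ F * (K * V * H ^ N) := key.trans (by gcongr)
  have hVbound : (F * K)⁻¹ ≤ V * H ^ N := by
    rw [inv_le_iff_one_le_mul₀ hFK]
    linarith
  rcases max_choice |aeval ξ D| |aeval ξ Q| with h | h
  · rw [hV, h] at hVbound
    exact (min_le_right _ _).trans hVbound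
  · exfalso
    rw [hV, h] at hVbound
    have : |aeval ξ Q| * H ^ N ≤ H ^ N * (H / g) ^ (-w) := by
      rw [mul_comm]
      gcongr
    linarith

/-- Lower bound for `|D(ξ)| M(D)^(2n-2)` for polynomials `D` of degree less than `n`, where `M` is
the Mahler measure. -/
theorem exists_lower_bound (hn : 2 ≤ n) (hP : IsBestApproxSeq n ξ P) {w : ℝ}
    (hw : ((2 * n - 2 : ℕ) : ℝ) < w) (hmem : w ∈ uniformExpSet n ξ) :
    ∃ c : ℝ, 0 < c ∧ c ≤ 1 ∧ ∀ D : ℤ[X], D ≠ 0 → D.natDegree ≤ n - 1 →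
      c ^ D.natDegree ≤ |aeval ξ D| * intMahler D ^ (2 * n - 2) := by
  obtain ⟨c₀, hc₀, hirr⟩ := hP.exists_lower_bound_irreducible hn hw hmem
  set N := 2 * n - 2 with hN
  set c : ℝ := min 1 (c₀ / (2 ^ n) ^ N) with hc
  have hcpos : 0 < c := lt_min one_pos (by positivity)
  have hconst : ∀ D : ℤ[X], D ≠ 0 → D.natDegree = 0 →
      1 ≤ |aeval ξ D| * intMahler D ^ N := by
    intro D hD0 hDdeg
    have h1 : 1 ≤ intMahler D ^ N := one_le_pow₀ (one_le_intMahler hD0)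
    obtain ⟨a, rfl⟩ := natDegree_eq_zero.mp hDdeg
    have ha : a ≠ 0 := by rintro rfl; simp at hD0
    have h2 : (1 : ℝ) ≤ |aeval ξ (C a)| := by
      rw [aeval_C, eq_intCast, ← Int.cast_abs]
      exact_mod_cast Int.one_le_abs ha
    exact one_le_mul_of_one_le_of_one_le h2 h1
  have hirr' : ∀ D : ℤ[X], Irreducible D → D.natDegree ≤ n - 1 →
      c ^ D.natDegree ≤ |aeval ξ D| * intMahler D ^ N := by
    intro D hD hDn
    rcases Nat.eq_zero_or_pos D.natDegree with h0 | h1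
    · rw [h0, pow_zero]
      exact hconst D hD.ne_zero h0
    · calc c ^ D.natDegree ≤ c := pow_le_of_le_one hcpos.le (min_le_left _ _) (by omega)
        _ ≤ c₀ / (2 ^ n) ^ N := min_le_right _ _
        _ ≤ |aeval ξ D| * intMahler D ^ N := by
          rw [div_le_iff₀ (by positivity), mul_assoc, ← mul_pow, mul_comm (intMahler D)]
          refine (hirr D hD h1 hDn).trans ?_
          gcongr
          exact polyHeight_le_intMahler (by omega)
  refine ⟨c, hcpos, min_le_left _ _, fun D => ?_⟩
  induction D using WfDvdMonoid.induction_on_irreducible with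
  | zero => exact fun h => (h rfl).elim
  | unit u hu =>
    intro hu0 _
    have h0 := natDegree_eq_zero_of_isUnit hu
    rw [h0, pow_zero]
    exact hconst u hu0 h0
  | mul A D hA hD ih =>
    intro _ hdeg
    rw [natDegree_mul hD.ne_zero hA] at hdeg ⊢
    rw [map_mul, abs_mul, intMahler_mul, mul_pow, pow_add, mul_mul_mul_comm]
    exact mul_le_mul (hirr' D hD (by omega)) (ih hA (by omega)) (by positivity)
      ((by positivity : (0 : ℝ) ≤ c ^ D.natDegree).trans (hirr' D hD (by omega)))

theorem isPrimitive (hP : IsBestApproxSeq n ξ P) {k : ℕ} (hk : 1 ≤ k) : (P k).IsPrimitive := by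
  rintro r ⟨Q, hQ⟩
  have hr0 : r ≠ 0 := by rintro rfl; exact hP.ne_zero k hk (by simp [hQ])
  have hQ0 : Q ≠ 0 := by rintro rfl; exact hP.ne_zero k hk (by simp [hQ])
  have hdeg : Q.natDegree ≤ n := by
    have := hP.deg_le k hk
    rwa [hQ, natDegree_C_mul hr0] at this
  have hheight : polyHeight Q ≤ polyHeight (P k) := by
    refine polyHeight_le fun j => ?_
    have h1 := abs_coeff_le_polyHeight (P k) j
    rw [← Int.cast_abs, Int.abs_eq_natAbs] at h1
    have h2 : ((P k).coeff j).natAbs ≤ polyHeight (P k) := by exact_mod_cast h1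
    rw [hQ, coeff_C_mul, Int.natAbs_mul, ← hQ] at h2
    exact (Nat.le_mul_of_pos_left _ (Int.natAbs_pos.mpr hr0)).trans h2
  have hmin := hP.isMin k hk Q hQ0 hdeg hheight
  have hpos := hP.abs_aeval_pos hk
  rw [hQ, map_mul, abs_mul, aeval_C, eq_intCast] at hmin hpos
  have hQpos : 0 < |aeval ξ Q| := pos_of_mul_pos_right hpos (abs_nonneg _)
  have hle : |(r : ℝ)| ≤ 1 := le_of_mul_le_mul_right (by linarith) hQpos
  rw [← Int.cast_abs] at hle
  have hle' : |r| ≤ 1 := by exact_mod_cast hle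
  have := Int.one_le_abs hr0
  rw [Int.isUnit_iff_abs_eq]
  omega

theorem eventually_irreducible (hn : 2 ≤ n) (hP : IsBestApproxSeq n ξ P) {w : ℝ}
    (hw : ((2 * n - 2 : ℕ) : ℝ) < w) (hmem : w ∈ uniformExpSet n ξ) :
    ∀ᶠ k in atTop, (P k).natDegree = n ∧ Irreducible (P k) := by
  obtain ⟨c, hc, hc1, hlow⟩ := hP.exists_lower_bound hn hw hmem
  set N := 2 * n - 2 with hN
  have hε : 0 < c ^ n / (n + 1) ^ N := by positivity
  filter_upwards [hP.tendsto_polyHeight.eventually hmem, hP.tendsto_polyHeight.eventually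
    (eventually_pow_mul_rpow_neg_lt hw one_pos hε), eventually_ge_atTop 1] with k hkw hkε hk
  obtain ⟨Q, hQn, hQH, hQpos, hQw⟩ := hkw
  have hQ0 : Q ≠ 0 := by rintro rfl; simp at hQpos
  have hk0 := hP.ne_zero k hk
  have hsmall : |aeval ξ (P k)| * intMahler (P k) ^ N < c ^ n := by
    have h1 : |aeval ξ (P k)| ≤ (polyHeight (P k) : ℝ) ^ (-w) :=
      (hP.isMin k hk Q hQ0 hQn (by exact_mod_cast hQH)).trans hQw.le
    have h2 : intMahler (P k) ^ N ≤ ((n + 1) * polyHeight (P k)) ^ N :=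
      pow_le_pow_left₀ (zero_le_one.trans (one_le_intMahler hk0))
        (intMahler_le_polyHeight (hP.deg_le k hk)) N
    rw [div_one, lt_div_iff₀ (by positivity)] at hkε
    calc |aeval ξ (P k)| * intMahler (P k) ^ N
        ≤ (polyHeight (P k) : ℝ) ^ (-w) * ((n + 1) * polyHeight (P k)) ^ N :=
          mul_le_mul h1 h2 (pow_nonneg (zero_le_one.trans (one_le_intMahler hk0)) _) (by positivity)
      _ = (polyHeight (P k) : ℝ) ^ N * (polyHeight (P k) : ℝ) ^ (-w) * (n + 1) ^ N := by
        rw [mul_pow]; ring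
      _ < c ^ n := hkε
  have hdeg : (P k).natDegree = n := by
    refine le_antisymm (hP.deg_le k hk) (not_lt.mp fun hlt => ?_)
    exact absurd ((pow_le_pow_of_le_one hc.le hc1 hlt.le).trans (hlow (P k) hk0 (by omega)))
      (not_le.mpr hsmall)
  refine ⟨hdeg, ⟨fun hu => ?_, fun A B hAB => ?_⟩⟩
  · have := natDegree_eq_zero_of_isUnit hu
    omega
  · by_contra! hcon
    have hpos : ∀ {U : ℤ[X]}, U ∣ P k → ¬ IsUnit U → 0 < U.natDegree := by
      intro U hU hnu
      refine Nat.pos_of_ne_zero fun h0 => hnu ?_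
      obtain ⟨a, rfl⟩ := natDegree_eq_zero.mp h0
      exact (hP.isPrimitive hk a hU).map C
    have hA := hpos ⟨B, hAB⟩ hcon.1
    have hB := hpos ⟨A, by rw [hAB, mul_comm]⟩ hcon.2
    have hA0 : A ≠ 0 := by rintro rfl; simp at hA
    have hB0 : B ≠ 0 := by rintro rfl; simp at hB
    have hsum : A.natDegree + B.natDegree = n := by rw [← hdeg, hAB, natDegree_mul hA0 hB0]
    refine absurd hsmall (not_lt.mpr ?_)
    rw [hAB, map_mul, abs_mul, intMahler_mul, mul_pow, mul_mul_mul_comm, ← hsum, pow_add]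
    exact mul_le_mul (hlow A hA0 (by omega)) (hlow B hB0 (by omega)) (by positivity)
      ((by positivity : (0 : ℝ) ≤ c ^ A.natDegree).trans (hlow A hA0 (by omega)))

theorem isCoprime_ratPoly (hP : IsBestApproxSeq n ξ P) {k : ℕ} (hk : 1 ≤ k)
    (h₁ : Irreducible (P k)) (h₂ : Irreducible (P (k + 1))) :
    IsCoprime (ratPoly (P k)) (ratPoly (P (k + 1))) := by
  have hp₁ := hP.isPrimitive hk
  have hirr : Irreducible (ratPoly (P k)) :=
    (IsPrimitive.Int.irreducible_iff_irreducible_map_cast hp₁).mp h₁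
  refine hirr.coprime_iff_not_dvd.mpr fun h => ?_
  have hdvd := (IsPrimitive.Int.dvd_iff_map_cast_dvd_map_cast _ _ hp₁).mpr h
  obtain ⟨u, hu⟩ := h₁.associated_of_dvd h₂ hdvd
  have hlt := hP.height_lt k hk
  obtain ⟨r, hr, hru⟩ := Polynomial.isUnit_iff.mp u.isUnit
  rw [← hu, ← hru] at hlt
  rcases Int.isUnit_iff.mp hr with rfl | rfl
  · simp at hlt
  · simp [polyHeight_neg] at hlt

end IsBestApproxSeq

theorem Lj_set_nonempty (n : ℕ) (hn : 2 ≤ n) (ξ q : ℝ) :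
    {y : ℝ | ∃ S : Finset (Polynomial ℤ), S.card = 2 * n - 1 ∧
      (∀ Q ∈ S, Q.natDegree ≤ 2 * n - 2) ∧
      LinearIndependent ℚ (fun Q : {x // x ∈ S} => ratPoly (Q : Polynomial ℤ)) ∧
      y = sSup ((fun Q => LPtraj n ξ Q q) '' (S : Set (Polynomial ℤ)))}.Nonempty := by
  have hinj : Function.Injective fun i : ℕ => (X : ℤ[X]) ^ i := fun i j h => by
    simpa using congrArg natDegree h
  refine ⟨_, (Finset.range (2 * n - 1)).image fun i => X ^ i, ?_, ?_, ?_, rfl⟩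
  · rw [Finset.card_image_of_injective _ hinj, Finset.card_range]
  · simp only [Finset.mem_image, Finset.mem_range]
    rintro Q ⟨i, hi, rfl⟩
    rw [natDegree_X_pow]
    omega
  · have hli : LinearIndependent ℚ fun i : ℕ => (X : ℚ[X]) ^ i := by
      simpa [X_pow_eq_monomial] using (Polynomial.basisMonomials ℚ).linearIndependent
    have heq : ∀ Q : {x // x ∈ (Finset.range (2 * n - 1)).image fun i => (X : ℤ[X]) ^ i},
        (Q : ℤ[X]) = X ^ (Q : ℤ[X]).natDegree := by
      rintro ⟨Q, hQ⟩
      obtain ⟨i, -, rfl⟩ := Finset.mem_image.mp hQ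
      simp
    convert hli.comp (fun Q : {x // x ∈ (Finset.range (2 * n - 1)).image
      fun i => (X : ℤ[X]) ^ i} => (Q : ℤ[X]).natDegree) ?_ using 1
    · funext Q
      conv_lhs => rw [heq Q]
      simp [ratPoly]
    · intro Q R h
      apply Subtype.ext
      rw [heq Q, heq R]
      exact congrArg (fun i => (X : ℤ[X]) ^ i) h

theorem exists_notMem_span {S : Finset ℤ[X]}
    (hli : LinearIndependent ℚ (fun Q : {x // x ∈ S} => ratPoly (Q : ℤ[X])))
    {ι : Type*} [Fintype ι] (v : ι → ℚ[X]) (hcard : Fintype.card ι < S.card) :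
    ∃ Q ∈ S, ratPoly Q ∉ Submodule.span ℚ (Set.range v) := by
  by_contra! hcon
  have hle : Submodule.span ℚ (Set.range fun Q : {x // x ∈ S} => ratPoly (Q : ℤ[X])) ≤
      Submodule.span ℚ (Set.range v) := by
    rw [Submodule.span_le]
    rintro _ ⟨Q, rfl⟩
    exact hcon Q Q.2
  have : Module.Finite ℚ (Submodule.span ℚ (Set.range v)) :=
    Module.Finite.span_of_finite ℚ (Set.finite_range v)
  have h1 := Submodule.finrank_mono hle
  rw [finrank_span_eq_card hli, Fintype.card_coe] at h1
  exact absurd (h1.trans (finrank_range_le_card v)) (not_le.mpr hcard)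

/-- Lower bound for the trajectories of any `2n-1` linearly independent polynomials, given two
coprime polynomials of degree `n`. -/
theorem lower_bound_of_isCoprime {n : ℕ} (hn : 2 ≤ n) (ξ : ℝ) {F G : ℤ[X]}
    (hF : F.natDegree = n) (hG : G.natDegree = n) (hFG : IsCoprime (ratPoly F) (ratPoly G))
    (hheight : polyHeight F ≤ polyHeight G) (hFξ : 0 < |aeval ξ F|)
    (heval : |aeval ξ G| ≤ |aeval ξ F|) {q y : ℝ}
    (hq : Real.log |aeval ξ F| + q = Real.log (polyHeight G) - q / (2 * (n : ℝ) - 2))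
    {S : Finset ℤ[X]} (hcard : S.card = 2 * n - 1) (hdeg : ∀ Q ∈ S, Q.natDegree ≤ 2 * n - 2)
    (hli : LinearIndependent ℚ (fun Q : {x // x ∈ S} => ratPoly (Q : ℤ[X])))
    (hy : ∀ Q ∈ S, LPtraj n ξ Q q ≤ y) :
    -Real.log ((2 * n - 1).factorial * max 1 |ξ| ^ n) ≤
      ((n : ℝ) - 1) * Real.log (polyHeight G) + ((n : ℝ) - 2) * Real.log (polyHeight F) +
        Real.log |aeval ξ F| + y + q / (2 * (n : ℝ) - 2) := by
  have hF0 : F ≠ 0 := by rintro rfl; simp at hF; omega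
  have hG0 : G ≠ 0 := by rintro rfl; simp at hG; omega
  have hinj : ∀ {A : ℤ[X]}, A ≠ 0 → ratPoly A ≠ 0 := fun {A} hA =>
    (Polynomial.map_ne_zero_iff (RingHom.injective_int (Int.castRingHom ℚ))).mpr hA
  have hshift := linearIndependent_shifts (hinj hF0) (hinj hG0) hFG (r := n - 1) (s := n - 1)
    (by rw [natDegree_ratPoly]; omega) (by rw [natDegree_ratPoly]; omega)
  obtain ⟨Q, hQS, hQ⟩ := exists_notMem_span hli
    (Sum.elim (fun i : Fin (n - 1) => X ^ (i : ℕ) * ratPoly F)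
      (fun j : Fin (n - 1) => X ^ (j : ℕ) * ratPoly G))
    (by rw [hcard, Fintype.card_sum, Fintype.card_fin]; omega)
  have hQ0 : Q ≠ 0 := by
    rintro rfl
    exact hQ (by simp [ratPoly])
  have hHF : (0 : ℝ) < polyHeight F := by exact_mod_cast one_le_polyHeight hF0
  have hHG : (0 : ℝ) < polyHeight G := by exact_mod_cast one_le_polyHeight hG0
  have hHQ : (0 : ℝ) < polyHeight Q := by exact_mod_cast one_le_polyHeight hQ0
  set K : ℝ := max 1 |ξ| ^ n with hK
  have hK1 : 1 ≤ K := one_le_pow₀ (le_max_left _ _)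
  set u := q / (2 * (n : ℝ) - 2) with hu
  set a := Real.log (polyHeight F) with ha
  set b := Real.log (polyHeight G) with hb
  set p := Real.log |aeval ξ F| with hp
  have hab : a ≤ b := Real.log_le_log hHF (by exact_mod_cast hheight)
  have hyQ := max_le_iff.mp (hy Q hQS)
  have hQh : (polyHeight Q : ℝ) ≤ Real.exp (y + u) := by
    rw [← Real.exp_log hHQ]
    exact Real.exp_le_exp.mpr (by linarith [hyQ.1])
  have hQe : |aeval ξ Q| ≤ Real.exp (y - q) := by
    rcases (abs_nonneg (aeval ξ Q)).eq_or_lt with h0 | hpos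
    · rw [← h0]; positivity
    · rw [← Real.exp_log hpos]
      exact Real.exp_le_exp.mpr (by linarith [hyQ.2])
  have hcast : ((n - 1 : ℕ) : ℝ) = (n : ℝ) - 1 := by
    rw [Nat.cast_sub (by omega)]; simp
  set T := ((n : ℝ) - 1) * b + ((n : ℝ) - 2) * a + p + y + u with hT
  have hfamdeg : ∀ {A : ℤ[X]}, A.natDegree = n → ∀ i : Fin (n - 1),
      (X ^ (i : ℕ) * A).natDegree < 2 * n - 1 := by
    intro A hA i
    have h := natDegree_mul_le (p := (X : ℤ[X]) ^ (i : ℕ)) (q := A)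
    rw [natDegree_X_pow] at h
    have := i.2
    omega
  have hcardO : Fintype.card (Option (Fin (n - 1) ⊕ Fin (n - 1))) = 2 * n - 1 := by
    rw [Fintype.card_option, Fintype.card_sum, Fintype.card_fin]; omega
  have hprod : ∏ o : Option (Fin (n - 1) ⊕ Fin (n - 1)),
      (o.elim (Real.exp (y + u)) (Sum.elim (fun _ => Real.exp a) fun _ => Real.exp b)) =
      Real.exp (y + u + (((n : ℝ) - 1) * a + ((n : ℝ) - 1) * b)) := by
    rw [Fintype.prod_option, Fintype.prod_sum_type]
    simp only [Option.elim, Sum.elim_inl, Sum.elim_inr, Finset.prod_const, Finset.card_univ,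
      Fintype.card_fin]
    rw [← Real.exp_nat_mul, ← Real.exp_nat_mul, hcast, ← Real.exp_add, ← Real.exp_add]
  have key := one_le_of_linearIndependent_ratPoly ξ
    (fun o : Option (Fin (n - 1) ⊕ Fin (n - 1)) => o.elim Q
      (Sum.elim (fun i => X ^ (i : ℕ) * F) fun j => X ^ (j : ℕ) * G))
    (by
      rw [hcardO]
      rintro (_ | i | j)
      · have := hdeg Q hQS
        simp only [Option.elim]
        omega
      · exact hfamdeg hF i
      · exact hfamdeg hG j)
    (by
      refine Eq.subst (motive := fun f => LinearIndependent ℚ f) (funext ?_)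
        (linearIndependent_option'.mpr ⟨hshift, hQ⟩)
      rintro (_ | i | j) <;> simp [ratPoly_X_pow_mul])
    (fun o => o.elim (Real.exp (y + u)) (Sum.elim (fun _ => Real.exp a) fun _ => Real.exp b))
    (fun o => o.elim (Real.exp (y - q)) fun _ => K * Real.exp p) (K * Real.exp T)
    (by
      rintro (_ | i | j) m
      · exact (abs_coeff_le_polyHeight Q m).trans hQh
      · simpa [ha, Real.exp_log hHF] using abs_coeff_X_pow_mul_le F i m
      · simpa [hb, Real.exp_log hHG] using abs_coeff_X_pow_mul_le G j m)
    (by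
      rw [hp, Real.exp_log hFξ]
      rintro (_ | i | j)
      · exact hQe
      · exact abs_aeval_X_pow_mul_le ξ F (by omega)
      · refine (abs_aeval_X_pow_mul_le (m := n) ξ G (by omega)).trans ?_
        simp only [Option.elim]
        gcongr)
    (by rintro (_ | i | j) <;> exact Real.exp_pos _)
    (by
      rw [hprod]
      rintro (_ | i | j)
      · simp only [Option.elim]
        rw [← Real.exp_add, mul_assoc, ← Real.exp_add]
        refine le_trans (Real.exp_le_exp.mpr ?_) (le_mul_of_one_le_left (Real.exp_pos _).le hK1)
        linarith
      · simp only [Option.elim, Sum.elim_inl]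
        rw [mul_assoc, mul_assoc, ← Real.exp_add, ← Real.exp_add]
        refine mul_le_mul_of_nonneg_left (Real.exp_le_exp.mpr ?_) (by positivity)
        linarith
      · simp only [Option.elim, Sum.elim_inr]
        rw [mul_assoc, mul_assoc, ← Real.exp_add, ← Real.exp_add]
        refine mul_le_mul_of_nonneg_left (Real.exp_le_exp.mpr ?_) (by positivity)
        linarith)
  rw [hcardO, ← mul_assoc] at key
  have hpos : (0 : ℝ) < (2 * n - 1).factorial * K := by positivity
  have hlog := Real.log_le_log one_pos key
  rw [Real.log_one, Real.log_mul hpos.ne' (Real.exp_pos _).ne', Real.log_exp] at hlog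
  linarith

/-- lower bound for the last successive minimum function at `q_k`. -/
theorem stmt11 (n : ℕ) (hn : 2 ≤ n) (ξ : ℝ)
    (P : ℕ → Polynomial ℤ) (hP : IsBestApproxSeq n ξ P)
    (hw : ((2*(n:ℝ)-2 : ℝ) : EReal) < wHat n ξ) :
    ∃ C : ℝ, 0 < C ∧ ∀ᶠ k in Filter.atTop, ∀ qk sk : ℝ, 0 < qk → 0 < sk →
      Real.log |Polynomial.aeval ξ (P (k-1))| + qk =
        Real.log (polyHeight (P k)) - qk / (2*(n:ℝ)-2) →
      Real.log (polyHeight (P (k-1))) - sk / (2*(n:ℝ)-2) =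
        Real.log |Polynomial.aeval ξ (P (k-1))| + sk →
      Lj n ξ (2*n-1) qk ≥ -(2*(n:ℝ)-2) * LPtraj n ξ (P (k-1)) qk
        + ((2*(n:ℝ)^2 - 5*(n:ℝ) + 2) / (2*(n:ℝ)-2)) * (qk - sk) - C := by
  obtain ⟨_, ⟨w, hmem, rfl⟩, hw⟩ := lt_sSup_iff.mp hw
  have hw' : ((2 * n - 2 : ℕ) : ℝ) < w := by
    rw [Nat.cast_sub (by omega)]
    push_cast
    exact EReal.coe_lt_coe_iff.mp hw
  set B : ℝ := Real.log ((2 * n - 1).factorial * max 1 |ξ| ^ n) with hB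
  refine ⟨|B| + 1, by positivity, ?_⟩
  have hirr := hP.eventually_irreducible hn hw' hmem
  filter_upwards [hirr, (tendsto_sub_atTop_nat 1).eventually hirr, eventually_ge_atTop 2]
    with k hk hk' hk2 qk sk _ _ hq hs
  obtain ⟨j, rfl⟩ : ∃ j, k = j + 1 := ⟨k - 1, by omega⟩
  simp only [Nat.add_sub_cancel] at hk' hq hs ⊢
  have hj : 1 ≤ j := by omega
  have hn' : (0 : ℝ) < 2 * n - 2 := by
    have : (2 : ℝ) ≤ n := by exact_mod_cast hn
    linarith
  have hHj : (0 : ℝ) < polyHeight (P j) := by exact_mod_cast one_le_polyHeight (hP.ne_zero j hj)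
  have hlog : Real.log (polyHeight (P j)) ≤ Real.log (polyHeight (P (j + 1))) :=
    Real.log_le_log hHj (by exact_mod_cast (hP.height_lt j hj).le)
  have htraj : LPtraj n ξ (P j) qk = Real.log |aeval ξ (P j)| + qk :=
    max_eq_right (by rw [hq]; linarith)
  rw [htraj, ge_iff_le, Lj]
  refine le_csInf (Lj_set_nonempty n hn ξ qk) ?_
  rintro y ⟨S, hcard, hdeg, hli, rfl⟩
  have hbound := lower_bound_of_isCoprime hn ξ hk'.1 hk.1
    (hP.isCoprime_ratPoly hj hk'.2 hk.2) (hP.height_lt j hj).le (hP.abs_aeval_pos hj)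
    (hP.eval_lt j hj).le hq hcard hdeg hli
    (fun Q hQ => le_csSup (S.finite_toSet.image _).bddAbove ⟨Q, hQ, rfl⟩)
  rw [← hB] at hbound
  set y := sSup ((fun Q => LPtraj n ξ Q qk) '' (S : Set (Polynomial ℤ)))
  obtain ⟨u, hu⟩ : ∃ u, qk = (2 * (n : ℝ) - 2) * u :=
    ⟨qk / (2 * n - 2), (mul_div_cancel₀ _ hn'.ne').symm⟩
  obtain ⟨t, ht⟩ : ∃ t, sk = (2 * (n : ℝ) - 2) * t :=
    ⟨sk / (2 * n - 2), (mul_div_cancel₀ _ hn'.ne').symm⟩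
  have hcoef : (2 * (n : ℝ) ^ 2 - 5 * n + 2) / (2 * n - 2) * (qk - sk) =
      (2 * (n : ℝ) ^ 2 - 5 * n + 2) * (u - t) := by
    rw [hu, ht, ← mul_sub, ← mul_assoc, div_mul_cancel₀ _ hn'.ne']
  have hqu : qk / (2 * (n : ℝ) - 2) = u := by rw [hu, mul_div_cancel_left₀ _ hn'.ne']
  have hst : sk / (2 * (n : ℝ) - 2) = t := by rw [ht, mul_div_cancel_left₀ _ hn'.ne']
  rw [hqu] at hbound hq
  rw [hst] at hs
  rw [hcoef]
  have hident : ((n : ℝ) - 1) * Real.log (polyHeight (P (j + 1))) +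
      ((n : ℝ) - 2) * Real.log (polyHeight (P j)) + Real.log |aeval ξ (P j)| + u =
      (2 * (n : ℝ) - 2) * (Real.log |aeval ξ (P j)| + qk) -
        (2 * (n : ℝ) ^ 2 - 5 * n + 2) * (u - t) := by
    rw [hu] at hq ⊢
    rw [ht] at hs
    linear_combination (-((n : ℝ) - 1)) * hq + ((n : ℝ) - 2) * hs
  have := le_abs_self B
  linarith
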